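/- Let k ≥ 1, let A be a finite abelian group, let G = ⟨c⟩ × A with c of order 2^k, and let H = ⟨c²⟩ × A. In Sym(G), let α_h (for h ∈ H) denote the right translation z ↦ z·h, and let β denote the map z ↦ z⁻¹·c. Then the subgroup ⟨α_h, β : h ∈ H⟩ acts transitively on G; since its order equals |G|, it acts regularly on G. -/

import Mathlib

/-- The generalized dihedral group on an abelian group `A`:
elements `r a` (for `a ∈ A`) together with reflections `sr a = x * r a`,
where `x` is an involution inverting `A`. -/
inductive GenDihedral (A : Type*) : Type _
  | r : A → GenDihedral A
  | sr : A → GenDihedral A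

namespace GenDihedral

variable {A : Type*} [CommGroup A]

def mul : GenDihedral A → GenDihedral A → GenDihedral A
  | r a, r b => r (a * b)
  | r a, sr b => sr (b * a⁻¹)
  | sr a, r b => sr (a * b)
  | sr a, sr b => r (b * a⁻¹)

instance : Mul (GenDihedral A) := ⟨mul⟩

def inv : GenDihedral A → GenDihedral A
  | r a => r a⁻¹
  | sr a => sr a

instance : Inv (GenDihedral A) := ⟨inv⟩
instance : One (GenDihedral A) := ⟨r 1⟩

@[simp] lemma r_mul_r (a b : A) : r a * r b = r (a * b) := rfl
@[simp] lemma r_mul_sr (a b : A) : r a * sr b = sr (b * a⁻¹) := rfl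
@[simp] lemma sr_mul_r (a b : A) : sr a * r b = sr (a * b) := rfl
@[simp] lemma sr_mul_sr (a b : A) : sr a * sr b = r (b * a⁻¹) := rfl
@[simp] lemma one_def : (1 : GenDihedral A) = r 1 := rfl
@[simp] lemma inv_r (a : A) : (r a)⁻¹ = r a⁻¹ := rfl
@[simp] lemma inv_sr (a : A) : (sr a)⁻¹ = sr a := rfl

instance : Group (GenDihedral A) where
  mul_assoc := by
    rintro (a | a) (b | b) (c | c) <;>
      simp [mul_comm, mul_left_comm, mul_assoc, mul_inv_rev]
  one_mul := by rintro (a | a) <;> simp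
  mul_one := by rintro (a | a) <;> simp
  inv_mul_cancel := by rintro (a | a) <;> simp

end GenDihedral

/-- The cyclic group of order `2^k`, written multiplicatively. -/
abbrev CycTwoPow (k : ℕ) := Multiplicative (ZMod (2 ^ k))

/-- A generator `c` of `C_{2^k}`; it has order `2^k`. -/
def cGen (k : ℕ) : CycTwoPow k := Multiplicative.ofAdd 1

/-- The element `c = (c, 1)` of `G = ⟨c⟩ × A`. -/
def cElt (k : ℕ) (A : Type*) [CommGroup A] : CycTwoPow k × A := (cGen k, 1)

/-- The subgroup `H = ⟨c²⟩ × A` of `G = ⟨c⟩ × A`. -/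
def Hsub (k : ℕ) (A : Type*) [CommGroup A] : Subgroup (CycTwoPow k × A) :=
  (Subgroup.zpowers ((cGen k) ^ 2)).prod ⊤

/-- Right translation `z ↦ z * h`, as a permutation of the group. -/
def rightTransl {G : Type*} [Group G] (h : G) : Equiv.Perm G := Equiv.mulRight h

/-- The permutation `β : z ↦ z⁻¹ * c` of `G = ⟨c⟩ × A`. -/
def betaInvMul (k : ℕ) (A : Type*) [CommGroup A] : Equiv.Perm (CycTwoPow k × A) :=
  (Equiv.inv (CycTwoPow k × A)).trans (Equiv.mulRight (cElt k A))

/-- The parity of the first coordinate. -/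
def parityAux (k : ℕ) (hk : 1 ≤ k) (A : Type*) [CommGroup A] (z : CycTwoPow k × A) : ZMod 2 :=
  ZMod.castHom (dvd_pow_self 2 (by omega : k ≠ 0)) (ZMod 2) (Multiplicative.toAdd z.1)

lemma parityAux_mul (k : ℕ) (hk : 1 ≤ k) (A : Type*) [CommGroup A] (x y : CycTwoPow k × A) :
    parityAux k hk A (x * y) = parityAux k hk A x + parityAux k hk A y := by
  simp only [parityAux, Prod.fst_mul, toAdd_mul, map_add]

lemma parityAux_inv (k : ℕ) (hk : 1 ≤ k) (A : Type*) [CommGroup A] (x : CycTwoPow k × A) :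
    parityAux k hk A x⁻¹ = parityAux k hk A x := by
  simp only [parityAux, Prod.fst_inv, toAdd_inv, map_neg, ZMod.neg_eq_self_mod_two]

lemma parityAux_c (k : ℕ) (hk : 1 ≤ k) (A : Type*) [CommGroup A] :
    parityAux k hk A (cElt k A) = 1 := by
  simp only [parityAux, cElt, cGen, toAdd_ofAdd, map_one]

lemma mem_Hsub_iff_parity (k : ℕ) (hk : 1 ≤ k) (A : Type*) [CommGroup A] (x : CycTwoPow k × A) :
    x ∈ Hsub k A ↔ parityAux k hk A x = 0 := by
  obtain ⟨a, b⟩ := x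
  simp only [Hsub, Subgroup.mem_prod, Subgroup.mem_top, and_true, Subgroup.mem_zpowers_iff,
    parityAux]
  constructor
  · rintro ⟨n, rfl⟩
    simp only [cGen, toAdd_zpow, toAdd_pow, toAdd_ofAdd, map_zsmul, map_nsmul, map_one]
    have : (2 • (1 : ZMod 2)) = 0 := by decide
    rw [this, smul_zero]
  · intro h
    obtain ⟨m, hm⟩ := ZMod.intCast_surjective (Multiplicative.toAdd a)
    rw [← hm, map_intCast, ZMod.intCast_zmod_eq_zero_iff_dvd] at h
    obtain ⟨n, rfl⟩ := h
    refine ⟨n, ?_⟩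
    apply Multiplicative.toAdd.injective
    rw [← hm]
    simp only [cGen, toAdd_zpow, toAdd_pow, toAdd_ofAdd]
    simp [mul_comm]

lemma closure_form (k : ℕ) (A : Type*) [CommGroup A] (f : Equiv.Perm (CycTwoPow k × A))
    (hf : f ∈ Subgroup.closure
      ({betaInvMul k A} ∪ Set.range fun h : Hsub k A => rightTransl (h : CycTwoPow k × A))) :
    (∃ h ∈ Hsub k A, ∀ z, f z = z * h) ∨ (∃ h ∈ Hsub k A, ∀ z, f z = z⁻¹ * cElt k A * h) := by
  induction hf using Subgroup.closure_induction with
  | mem x hx =>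
    rcases hx with hx | ⟨h, rfl⟩
    · rw [Set.mem_singleton_iff] at hx
      subst hx
      exact Or.inr ⟨1, one_mem _, fun z => by simp [betaInvMul]⟩
    · exact Or.inl ⟨h, h.2, fun z => rfl⟩
  | one => exact Or.inl ⟨1, one_mem _, fun z => by simp⟩
  | mul x y _ _ hx hy =>
    rcases hx with ⟨h, hh, hx⟩ | ⟨h, hh, hx⟩ <;> rcases hy with ⟨g, hg, hy⟩ | ⟨g, hg, hy⟩
    · exact Or.inl ⟨g * h, mul_mem hg hh, fun z => by
        rw [Equiv.Perm.mul_apply, hy, hx, mul_assoc]⟩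
    · exact Or.inr ⟨g * h, mul_mem hg hh, fun z => by
        rw [Equiv.Perm.mul_apply, hy, hx, mul_assoc]⟩
    · exact Or.inr ⟨g⁻¹ * h, mul_mem (inv_mem hg) hh, fun z => by
        rw [Equiv.Perm.mul_apply, hy, hx, mul_inv]; simp only [mul_assoc, mul_left_comm]⟩
    · refine Or.inl ⟨g⁻¹ * h, mul_mem (inv_mem hg) hh, fun z => ?_⟩
      rw [Equiv.Perm.mul_apply, hy, hx, mul_inv, mul_inv, inv_inv]
      have : z * (cElt k A)⁻¹ * g⁻¹ * cElt k A * h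
          = z * (g⁻¹ * h) * ((cElt k A)⁻¹ * cElt k A) := by
        simp only [mul_assoc, mul_left_comm, mul_comm]
      rw [this, inv_mul_cancel, mul_one]
  | inv x _ hx =>
    rcases hx with ⟨h, hh, hx⟩ | ⟨h, hh, hx⟩
    · exact Or.inl ⟨h⁻¹, inv_mem hh, fun z => by
        rw [Equiv.Perm.inv_eq_iff_eq, hx, inv_mul_cancel_right]⟩
    · refine Or.inr ⟨h, hh, fun z => ?_⟩
      rw [Equiv.Perm.inv_eq_iff_eq, hx, mul_assoc, mul_assoc, mul_inv, inv_inv,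
        inv_mul_cancel_right]

lemma closure_trans (k : ℕ) (hk : 1 ≤ k) (A : Type*) [CommGroup A] (u v : CycTwoPow k × A) :
    ∃ f ∈ Subgroup.closure
      ({betaInvMul k A} ∪ Set.range fun h : Hsub k A => rightTransl (h : CycTwoPow k × A)),
      f u = v := by
  by_cases h : u⁻¹ * v ∈ Hsub k A
  · exact ⟨rightTransl (u⁻¹ * v), Subgroup.subset_closure (Or.inr ⟨⟨_, h⟩, rfl⟩),
      mul_inv_cancel_left u v⟩
  · have h' : (cElt k A)⁻¹ * (u * v) ∈ Hsub k A := by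
      rw [mem_Hsub_iff_parity k hk] at h ⊢
      rw [parityAux_mul, parityAux_inv] at h ⊢
      rw [parityAux_c, parityAux_mul]
      generalize parityAux k hk A u = a at *
      generalize parityAux k hk A v = b at *
      revert a b
      decide
    refine ⟨rightTransl ((cElt k A)⁻¹ * (u * v)) * betaInvMul k A,
      mul_mem (Subgroup.subset_closure (Or.inr ⟨⟨_, h'⟩, rfl⟩))
        (Subgroup.subset_closure (Or.inl rfl)), ?_⟩
    change (u⁻¹ * cElt k A) * ((cElt k A)⁻¹ * (u * v)) = v
    rw [mul_assoc, mul_inv_cancel_left, inv_mul_cancel_left]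

lemma closure_free (k : ℕ) (hk : 1 ≤ k) (A : Type*) [CommGroup A] (u : CycTwoPow k × A)
    (f g : Equiv.Perm (CycTwoPow k × A))
    (hf : f ∈ Subgroup.closure
      ({betaInvMul k A} ∪ Set.range fun h : Hsub k A => rightTransl (h : CycTwoPow k × A)))
    (hg : g ∈ Subgroup.closure
      ({betaInvMul k A} ∪ Set.range fun h : Hsub k A => rightTransl (h : CycTwoPow k × A)))
    (hfg : f u = g u) : f = g := by
  have key : ∀ x y : CycTwoPow k × A, x ∈ Hsub k A → y ∈ Hsub k A →
      u * x ≠ u⁻¹ * cElt k A * y := by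
    intro x y hx hy e
    rw [mem_Hsub_iff_parity k hk] at hx hy
    have e' := congrArg (parityAux k hk A) e
    simp only [parityAux_mul, parityAux_inv, parityAux_c, hx, hy] at e'
    generalize parityAux k hk A u = a at *
    revert a
    decide
  rcases closure_form k A f hf with ⟨x, hx, h1⟩ | ⟨x, hx, h1⟩ <;>
    rcases closure_form k A g hg with ⟨y, hy, h2⟩ | ⟨y, hy, h2⟩ <;>
    rw [h1, h2] at hfg
  · ext1 z
    rw [h1, h2, mul_left_cancel hfg]
  · exact (key x y hx hy hfg).elim
  · exact (key y x hy hx hfg.symm).elim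
  · ext1 z
    rw [h1, h2, mul_left_cancel hfg]

/-- For `G = ⟨c⟩ × A` with `c` of order `2^k` (`k ≥ 1`, `A` finite abelian)
and `H = ⟨c²⟩ × A`, the subgroup of `Sym(G)` generated by the right translations
`α_h : z ↦ z * h` (`h ∈ H`) and `β : z ↦ z⁻¹ * c` acts transitively on `G`; its order equals
`|G|`, and it acts regularly on `G`. -/
theorem translations_and_inversion_act_regularly
    (k : ℕ) (hk : 1 ≤ k) (A : Type*) [CommGroup A] [Finite A] :
    (∀ u v : CycTwoPow k × A,
      ∃ f ∈ Subgroup.closure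
          ({betaInvMul k A} ∪ Set.range fun h : Hsub k A => rightTransl (h : CycTwoPow k × A)),
        f u = v) ∧
    Nat.card (Subgroup.closure
        ({betaInvMul k A} ∪ Set.range fun h : Hsub k A => rightTransl (h : CycTwoPow k × A))) =
      Nat.card (CycTwoPow k × A) ∧
    (∀ u v : CycTwoPow k × A,
      ∃! f : (Subgroup.closure
          ({betaInvMul k A} ∪ Set.range fun h : Hsub k A => rightTransl (h : CycTwoPow k × A))),
        (f : Equiv.Perm (CycTwoPow k × A)) u = v) := by
  refine ⟨closure_trans k hk A, ?_, fun u v => ?_⟩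
  · refine Nat.card_eq_of_bijective
      (fun f => (f : Equiv.Perm (CycTwoPow k × A)) 1) ⟨?_, ?_⟩
    · intro f g hfg
      exact Subtype.ext (closure_free k hk A 1 f g f.2 g.2 hfg)
    · intro v
      obtain ⟨f, hf, e⟩ := closure_trans k hk A 1 v
      exact ⟨⟨f, hf⟩, e⟩
  · obtain ⟨f, hf, e⟩ := closure_trans k hk A u v
    refine ⟨⟨f, hf⟩, e, fun g hg => ?_⟩
    exact Subtype.ext (closure_free k hk A u g f g.2 hf (hg.trans e.symm))
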